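/- Let n ≥ 3. On the SU(2)-Yang–Mills phase manifold of dimension 4n + 3n(n−1)/2, the n-form Λ = −*F_a ∧ dA^a + (1/2) F^a ∧ *F_a − (1/8) γ^c_{ab} A^a ∧ A^b ∧ *F_c satisfies dΛ = Σ_a θ^a ∧ ψ_a, where θ^a = dA^a − F^a + (1/8) γ^a_{bc} A^b ∧ A^c and ψ_a = −d(*F_a) − (1/4) γ^c_{ab} A^b ∧ *F_c; in particular the (n+1)-form Σ_a θ^a ∧ ψ_a is closed. -/

import Mathlib

open scoped BigOperators

noncomputable section

namespace EDS

/-- Points of the model space `ℝ^ι` with coordinates indexed by `ι`. -/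
abbrev Pt (ι : Type) : Type := ι → ℝ

/-- A differential `p`-form on `ℝ^ι`, represented by its (antisymmetric)
coefficient functions: `ω idx` is the coefficient `ω_{idx 0 … idx (p-1)}`. -/
abbrev PForm (ι : Type) (p : ℕ) : Type := (Fin p → ι) → Pt ι → ℝ

variable {ι : Type} [Fintype ι] [DecidableEq ι]

/-- A `0`-form from a function. -/
def ofFun (f : Pt ι → ℝ) : PForm ι 0 := fun _ => f

/-- Partial derivative in the coordinate direction `u`. -/
def pd (u : ι) (f : Pt ι → ℝ) : Pt ι → ℝ :=
  fun x => fderiv ℝ f x (Pi.single u 1)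

/-- Exterior derivative, in coefficient form:
`(dω)_{i₀…i_p} = Σ_k (-1)^k ∂_{i_k} ω_{i₀…î_k…i_p}`. -/
def extd {p : ℕ} (ω : PForm ι p) : PForm ι (p + 1) :=
  fun idx x => ∑ k : Fin (p + 1), (-1 : ℝ) ^ (k : ℕ) * pd (idx k) (ω (idx ∘ k.succAbove)) x

/-- Wedge product, in coefficient form:
`(ω∧η)_{i₁…i_{p+q}} = (1/(p!q!)) Σ_{σ ∈ S_{p+q}} sgn σ · ω_{i_{σ(1)}…i_{σ(p)}} η_{i_{σ(p+1)}…i_{σ(p+q)}}`. -/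
def wedge {p q : ℕ} (ω : PForm ι p) (η : PForm ι q) : PForm ι (p + q) :=
  fun idx x => ((p.factorial * q.factorial : ℕ) : ℝ)⁻¹ *
    ∑ σ : Equiv.Perm (Fin (p + q)), ((Equiv.Perm.sign σ : ℤ) : ℝ) *
      (ω (fun i => idx (σ (Fin.castAdd q i))) x * η (fun j => idx (σ (Fin.natAdd p j))) x)

infixl:72 " ⋏ " => wedge

/-- Wedge product of a family of `1`-forms. -/
def wedgeFam {m : ℕ} (α : Fin m → PForm ι 1) : PForm ι m :=
  fun idx x => ∑ σ : Equiv.Perm (Fin m), ((Equiv.Perm.sign σ : ℤ) : ℝ) *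
    ∏ t, α t (fun _ => idx (σ t)) x

/-- Multiplication of a `p`-form by a scalar function. -/
def fsmul (f : Pt ι → ℝ) {p : ℕ} (ω : PForm ι p) : PForm ι p := fun idx x => f x * ω idx x

/-- Reinterpret a `p`-form as a `q`-form along a proof `p = q`. -/
def PForm.cast {p q : ℕ} (h : p = q) (ω : PForm ι p) : PForm ι q :=
  fun idx x => ω (fun i => idx (Fin.cast h i)) x

/-- The totally antisymmetric Levi-Civita symbol `ε`, with `ε(id) = 1`. -/
def eps {m : ℕ} (f : Fin m → Fin m) : ℝ :=
  if h : Function.Bijective f then ((Equiv.Perm.sign (Equiv.ofBijective f h) : ℤ) : ℝ) else 0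

/-- The Lorentz (Minkowski) metric `η = diag(-1,1,…,1)` (diagonal entries). -/
def etaD {m : ℕ} (i : Fin m) : ℝ := if (i : ℕ) = 0 then -1 else 1

/-- Assemble the index tuple `(i, j, k₁, …, k_{n-2})` as a map `Fin n → Fin n`. -/
def raiseIdx {n : ℕ} (i j : Fin n) (k : Fin (n - 2) → Fin n) : Fin n → Fin n :=
  fun t => if h0 : (t : ℕ) = 0 then i else if h1 : (t : ℕ) = 1 then j
    else k ⟨(t : ℕ) - 2, by have := t.isLt; omega⟩

/-! ### The SU(2)-Yang--Mills phase manifold in `n` spacetime dimensions -/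

/-- Index type for the coordinates `A^a_i`, `F^a_{ij}` (`i < j`), `x^i` of the
SU(2)-Yang--Mills phase manifold of dimension `4n + 3n(n-1)/2`. -/
abbrev YC (n : ℕ) : Type :=
  (Fin 3 × Fin n) ⊕ ((Fin 3 × {p : Fin n × Fin n // p.1 < p.2}) ⊕ Fin n)

/-- The totally antisymmetric SU(2) structure constants `γ^a_{bc} = ε_{abc}`:
`gam a b c` is `γ^a_{bc}`, with `γ^1_{23} = 1`. -/
def gam (a b c : Fin 3) : ℝ := eps ![a, b, c]

/-- The coordinate function `x^i`. -/
def xc (n : ℕ) (i : Fin n) : Pt (YC n) → ℝ := fun m => m (Sum.inr (Sum.inr i))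

/-- The coordinate function `A^a_i`. -/
def Ac (n : ℕ) (a : Fin 3) (i : Fin n) : Pt (YC n) → ℝ := fun m => m (Sum.inl (a, i))

/-- The antisymmetric arrays `F^a_{ij} = -F^a_{ji}` built from the coordinates
`F^a_{ij}`, `i < j`. -/
def Fc (n : ℕ) (a : Fin 3) (i j : Fin n) : Pt (YC n) → ℝ := fun m =>
  if h : i < j then m (Sum.inr (Sum.inl (a, ⟨(i, j), h⟩)))
  else if h' : j < i then - m (Sum.inr (Sum.inl (a, ⟨(j, i), h'⟩))) else 0

/-- The coordinate `1`-forms `dx^i`. -/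
def dx (n : ℕ) (i : Fin n) : PForm (YC n) 1 := extd (ofFun (xc n i))

/-- The potential `1`-forms `A^a = A^a_i dx^i`. -/
def Aform (n : ℕ) (a : Fin 3) : PForm (YC n) 1 := ∑ i, fsmul (Ac n a i) (dx n i)

/-- The field `2`-forms `F^a = (1/2) F^a_{ij} dx^i ∧ dx^j`. -/
def Fform (n : ℕ) (a : Fin 3) : PForm (YC n) 2 :=
  (1/2 : ℝ) • ∑ i, ∑ j, fsmul (Fc n a i j) (dx n i ⋏ dx n j)

/-- The dual field `(n-2)`-forms
`*F_a = (1/(2(n-2)!)) F^{a ij} ε_{ij}{}^{k₁…k_{n-2}} dx^{k₁} ∧ ⋯ ∧ dx^{k_{n-2}}`,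
indices raised with the Lorentz metric `η = diag(-1,1,…,1)`. -/
def starF (n : ℕ) (a : Fin 3) : PForm (YC n) (n - 2) :=
  ((2 * (n - 2).factorial : ℕ) : ℝ)⁻¹ • ∑ i, ∑ j, ∑ k : Fin (n - 2) → Fin n,
    (etaD i * etaD j * (∏ t, etaD (k t)) * eps (raiseIdx i j k)) •
      fsmul (Fc n a i j) (wedgeFam (fun t => dx n (k t)))

/-- The `2`-forms `θ^a = dA^a - F^a + (1/8) γ^a_{bc} A^b ∧ A^c`. -/
def theta (n : ℕ) (a : Fin 3) : PForm (YC n) 2 :=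
  extd (Aform n a) - Fform n a +
    (1/8 : ℝ) • ∑ b, ∑ c, gam a b c • (Aform n b ⋏ Aform n c)

/-- The `(n-1)`-forms `ψ_a = -d(*F_a) - (1/4) γ^c_{ab} A^b ∧ *F_c`. -/
def psi (n : ℕ) (a : Fin 3) : PForm (YC n) (n - 2 + 1) :=
  -(extd (starF n a)) -
    PForm.cast (show 1 + (n - 2) = n - 2 + 1 by omega)
      ((1/4 : ℝ) • ∑ b, ∑ c, gam c a b • (Aform n b ⋏ starF n c))

end EDS

open EDS

set_option linter.unusedSectionVars false

namespace EDS

variable {ι : Type} [Fintype ι] [DecidableEq ι]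

/-- Exterior algebra in which forms are evaluated pointwise. -/
abbrev EA (ι : Type) : Type := ExteriorAlgebra ℝ (ι → ℝ)

def bas (u : ι) : EA ι := ExteriorAlgebra.ι ℝ (Pi.single u (1:ℝ))

def mon {p : ℕ} (I : Fin p → ι) : EA ι :=
  ExteriorAlgebra.ιMulti ℝ p (fun t => (Pi.single (I t) (1:ℝ) : ι → ℝ))

def Phi {p : ℕ} (ω : PForm ι p) (x : Pt ι) : EA ι :=
  ((p.factorial : ℝ))⁻¹ • ∑ I : Fin p → ι, ω I x • mon I

def detForm {p : ℕ} (idx : Fin p → ι) : (ι → ℝ) [⋀^Fin p]→ₗ[ℝ] ℝ :=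
  (Matrix.detRowAlternating (n := Fin p) (R := ℝ)).compLinearMap (LinearMap.funLeft ℝ ℝ idx)

def cf {p : ℕ} (idx : Fin p → ι) : EA ι →ₗ[ℝ] ℝ :=
  ExteriorAlgebra.liftAlternating
    (Function.update (0 : ∀ i, (ι → ℝ) [⋀^Fin i]→ₗ[ℝ] ℝ) p (detForm idx))

theorem cf_mon_det {p : ℕ} (idx K : Fin p → ι) :
    cf idx (mon K) = Matrix.det (Matrix.of fun t s : Fin p => (Pi.single (K t) (1:ℝ) : ι → ℝ) (idx s)) := by
  unfold cf mon
  rw [ExteriorAlgebra.liftAlternating_apply_ιMulti, Function.update_self]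
  rfl

theorem cf_mon {p : ℕ} (idx K : Fin p → ι) :
    cf idx (mon K) = ∑ σ : Equiv.Perm (Fin p), ((Equiv.Perm.sign σ : ℤ) : ℝ) *
      (if K = idx ∘ σ then 1 else 0) := by
  rw [cf_mon_det, ← Matrix.det_transpose, Matrix.det_apply']
  refine Finset.sum_congr rfl fun σ _ => ?_
  congr 1
  split_ifs with h
  · subst h
    exact Finset.prod_eq_one fun i _ => by simp [Matrix.transpose]
  · have : ∃ t, K t ≠ idx (σ t) := by
      by_contra hc
      push Not at hc
      exact h (funext hc)
    obtain ⟨t, ht⟩ := this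
    refine Finset.prod_eq_zero (Finset.mem_univ t) ?_
    simp [Matrix.transpose, Pi.single_apply, ht.symm]

theorem mon_perm {p : ℕ} (I : Fin p → ι) (σ : Equiv.Perm (Fin p)) :
    mon (I ∘ σ) = ((Equiv.Perm.sign σ : ℤ) : ℝ) • mon I := by
  unfold mon
  have := (ExteriorAlgebra.ιMulti ℝ p).map_perm (fun t => (Pi.single (I t) (1:ℝ) : ι → ℝ)) σ
  refine Eq.trans ?_ (this.trans ?_)
  · rfl
  · rw [Units.smul_def, ← Int.cast_smul_eq_zsmul ℝ]

theorem sum_cf_mon {p : ℕ} (K : Fin p → ι) :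
    ((p.factorial : ℝ))⁻¹ • ∑ I : Fin p → ι, cf I (mon K) • mon I = mon K := by
  simp_rw [cf_mon, Finset.sum_smul]
  rw [Finset.sum_comm]
  have : ∀ σ : Equiv.Perm (Fin p), ∑ I : Fin p → ι, (((Equiv.Perm.sign σ : ℤ) : ℝ) *
      (if K = I ∘ σ then 1 else 0)) • mon I = mon K := by
    intro σ
    rw [Finset.sum_eq_single (K ∘ σ.symm)]
    · rw [if_pos (by ext t; simp), mon_perm]
      rw [smul_smul, Equiv.Perm.sign_symm]
      rcases Int.units_eq_one_or (Equiv.Perm.sign σ) with h | h <;> simp [h]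
    · intro I _ hI
      rw [if_neg]
      · simp
      · rintro rfl
        apply hI
        ext t; simp
    · simp
  simp_rw [this]
  simp only [Finset.sum_const, Finset.card_univ, Fintype.card_perm, Fintype.card_fin]
  rw [← Nat.cast_smul_eq_nsmul ℝ, smul_smul, inv_mul_cancel₀, one_smul]
  exact_mod_cast p.factorial_ne_zero

theorem mon_append {p q : ℕ} (I : Fin p → ι) (J : Fin q → ι) :
    mon I * mon J = mon (Fin.append I J) := by
  unfold mon
  rw [ExteriorAlgebra.ιMulti_mul_ιMulti]
  congr 1
  ext t : 1
  refine Fin.addCases (fun i => ?_) (fun i => ?_) t <;> simp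

theorem mon_cons {p : ℕ} (u : ι) (J : Fin p → ι) :
    mon (Fin.cons u J : Fin (p+1) → ι) = bas u * mon J := by
  unfold mon bas
  rw [ExteriorAlgebra.ιMulti_succ_apply]
  rfl

theorem bas_sq (u : ι) : bas u * bas u = 0 := ExteriorAlgebra.ι_sq_zero _

theorem bas_swap (u v : ι) : bas u * bas v = - (bas v * bas u) :=
  eq_neg_of_add_eq_zero_left (ExteriorAlgebra.ι_add_mul_swap _ _)

theorem bas_mon {p : ℕ} (u : ι) (J : Fin p → ι) :
    bas u * mon J = (-1 : ℝ) ^ p • (mon J * bas u) := by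
  induction p with
  | zero => simp [mon]
  | succ p ih =>
    rw [← Fin.cons_self_tail J, mon_cons, ← mul_assoc, bas_swap, neg_mul, mul_assoc, ih]
    rw [mul_smul_comm, pow_succ, ← mul_assoc]
    simp

/-- `Phi` as a sum over monomials in span -/
theorem sum_cf {p : ℕ} {v : EA ι} (hv : v ∈ Submodule.span ℝ (Set.range (mon (ι := ι) (p := p)))) :
    ((p.factorial : ℝ))⁻¹ • ∑ I : Fin p → ι, cf I v • mon I = v := by
  induction hv using Submodule.span_induction with
  | mem x h => obtain ⟨K, rfl⟩ := h; exact sum_cf_mon K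
  | zero => simp
  | add x y _ _ hx hy =>
    simp only [map_add, add_smul, Finset.sum_add_distrib, smul_add, hx, hy]
  | smul a x _ hx =>
    simp only [map_smul, smul_eq_mul, mul_smul, ← Finset.smul_sum]
    rw [smul_comm, hx]

theorem Phi_mem {p : ℕ} (ω : PForm ι p) (x : Pt ι) :
    Phi ω x ∈ Submodule.span ℝ (Set.range (mon (ι := ι) (p := p))) :=
  Submodule.smul_mem _ _ (Submodule.sum_mem _ fun I _ =>
    Submodule.smul_mem _ _ (Submodule.subset_span ⟨I, rfl⟩))

theorem Phi_mul {p q : ℕ} (ω : PForm ι p) (η : PForm ι q) (x : Pt ι) :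
    Phi ω x * Phi η x = ((p.factorial * q.factorial : ℕ) : ℝ)⁻¹ •
      ∑ K : Fin (p + q) → ι, (ω (fun i => K (Fin.castAdd q i)) x *
        η (fun j => K (Fin.natAdd p j)) x) • mon K := by
  unfold Phi
  rw [smul_mul_smul_comm, Finset.sum_mul_sum, ← Finset.sum_product', ← mul_inv, Nat.cast_mul]
  congr 1
  rw [Finset.univ_product_univ]
  refine Fintype.sum_equiv (Fin.appendEquiv p q) _ _ fun z => ?_
  rw [smul_mul_smul_comm, mon_append]
  simp [Fin.appendEquiv]

theorem wedge_eq {p q : ℕ} (ω : PForm ι p) (η : PForm ι q) (idx : Fin (p + q) → ι) (x : Pt ι) :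
    (ω ⋏ η) idx x = cf idx (Phi ω x * Phi η x) := by
  rw [Phi_mul, map_smul, map_sum]
  unfold wedge
  rw [smul_eq_mul]
  congr 1
  simp_rw [map_smul, cf_mon, smul_eq_mul, Finset.mul_sum]
  rw [Finset.sum_comm]
  refine Finset.sum_congr rfl fun σ _ => ?_
  rw [Finset.sum_eq_single (idx ∘ σ)]
  · simp; ring
  · intro K _ hK
    simp [hK]
  · simp

theorem Phi_wedge {p q : ℕ} (ω : PForm ι p) (η : PForm ι q) (x : Pt ι) :
    Phi (ω ⋏ η) x = Phi ω x * Phi η x := by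
  have h : Phi ω x * Phi η x ∈ Submodule.span ℝ (Set.range (mon (ι := ι) (p := p + q))) := by
    rw [Phi_mul]
    exact Submodule.smul_mem _ _ (Submodule.sum_mem _ fun I _ =>
      Submodule.smul_mem _ _ (Submodule.subset_span ⟨I, rfl⟩))
  conv_rhs => rw [← sum_cf h]
  unfold Phi
  simp_rw [wedge_eq]
  rfl

/-- Being antisymmetric -/
def Good {p : ℕ} (ω : PForm ι p) : Prop := ∀ idx x, ω idx x = cf idx (Phi ω x)

theorem Good.ext {p : ℕ} {ω η : PForm ι p} (h1 : Good ω) (h2 : Good η)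
    (h : ∀ x, Phi ω x = Phi η x) : ω = η := by
  funext idx x
  rw [h1, h2, h]

theorem good_wedge {p q : ℕ} (ω : PForm ι p) (η : PForm ι q) : Good (ω ⋏ η) := by
  intro idx x
  rw [wedge_eq, Phi_wedge]

theorem Phi_add {p : ℕ} (ω η : PForm ι p) (x : Pt ι) : Phi (ω + η) x = Phi ω x + Phi η x := by
  simp [Phi, add_smul, Finset.sum_add_distrib]

theorem Phi_neg {p : ℕ} (ω : PForm ι p) (x : Pt ι) : Phi (-ω) x = - Phi ω x := by
  simp [Phi]

theorem Phi_sub {p : ℕ} (ω η : PForm ι p) (x : Pt ι) : Phi (ω - η) x = Phi ω x - Phi η x := by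
  rw [sub_eq_add_neg, Phi_add, Phi_neg, sub_eq_add_neg]

theorem Phi_zero {p : ℕ} (x : Pt ι) : Phi (0 : PForm ι p) x = 0 := by
  simp [Phi]

theorem Phi_smul {p : ℕ} (c : ℝ) (ω : PForm ι p) (x : Pt ι) : Phi (c • ω) x = c • Phi ω x := by
  simp only [Phi, Pi.smul_apply, smul_eq_mul, mul_smul, ← Finset.smul_sum]
  rw [smul_comm]

theorem Phi_fsmul {p : ℕ} (f : Pt ι → ℝ) (ω : PForm ι p) (x : Pt ι) :
    Phi (fsmul f ω) x = f x • Phi ω x := by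
  simp only [Phi, fsmul, mul_smul, ← Finset.smul_sum]
  rw [smul_comm]

theorem Phi_sum {p : ℕ} {κ : Type*} (s : Finset κ) (ω : κ → PForm ι p) (x : Pt ι) :
    Phi (∑ k ∈ s, ω k) x = ∑ k ∈ s, Phi (ω k) x := by
  classical
  induction s using Finset.induction_on with
  | empty => simp [Phi_zero]
  | insert a s ha ih => rw [Finset.sum_insert ha, Finset.sum_insert ha, Phi_add, ih]

theorem Phi_cast {p q : ℕ} (h : p = q) (ω : PForm ι p) (x : Pt ι) :
    Phi (PForm.cast h ω) x = Phi ω x := by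
  subst h; rfl

theorem good_zero {p : ℕ} : Good (0 : PForm ι p) := by
  intro idx x; simp [Phi_zero]

theorem Good.add {p : ℕ} {ω η : PForm ι p} (h1 : Good ω) (h2 : Good η) : Good (ω + η) := by
  intro idx x
  rw [Phi_add, map_add, ← h1, ← h2]; rfl

theorem Good.smul {p : ℕ} {ω : PForm ι p} (h1 : Good ω) (c : ℝ) : Good (c • ω) := by
  intro idx x
  rw [Phi_smul, map_smul, ← h1]; rfl

theorem Good.neg {p : ℕ} {ω : PForm ι p} (h1 : Good ω) : Good (-ω) := by
  intro idx x
  rw [Phi_neg, map_neg, ← h1]; rfl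

theorem Good.sub {p : ℕ} {ω η : PForm ι p} (h1 : Good ω) (h2 : Good η) : Good (ω - η) := by
  rw [sub_eq_add_neg]; exact h1.add h2.neg

theorem Good.sum {p : ℕ} {κ : Type*} {s : Finset κ} {ω : κ → PForm ι p}
    (h : ∀ k, Good (ω k)) : Good (∑ k ∈ s, ω k) := by
  classical
  induction s using Finset.induction_on with
  | empty => simpa using good_zero
  | insert a s ha ih => rw [Finset.sum_insert ha]; exact (h a).add ih

theorem Good.cast {p q : ℕ} (h : p = q) {ω : PForm ι p} (h1 : Good ω) :
    Good (PForm.cast h ω) := by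
  subst h; exact h1

/-- Coefficientwise partial derivative. -/
def pD {p : ℕ} (u : ι) (ω : PForm ι p) : PForm ι p := fun idx => pd u (ω idx)

/-- Smooth forms. -/
def Sm {p : ℕ} (ω : PForm ι p) : Prop := ∀ idx, ContDiff ℝ (⊤ : ℕ∞) (ω idx)

theorem Sm.diff {p : ℕ} {ω : PForm ι p} (h : Sm ω) (idx : Fin p → ι) (x : Pt ι) :
    DifferentiableAt ℝ (ω idx) x :=
  (h idx).differentiable (by simp) x

theorem sm_pd {f : Pt ι → ℝ} (hf : ContDiff ℝ (⊤ : ℕ∞) f) (u : ι) :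
    ContDiff ℝ (⊤ : ℕ∞) (pd u f) := by
  unfold pd
  exact (hf.fderiv_right (m := (⊤ : ℕ∞)) (by simp)).clm_apply contDiff_const

theorem Sm.extd {p : ℕ} {ω : PForm ι p} (h : Sm ω) : Sm (extd ω) := by
  intro idx
  unfold EDS.extd
  exact ContDiff.sum fun k _ => contDiff_const.mul (sm_pd (h _) _)

theorem Sm.wedge {p q : ℕ} {ω : PForm ι p} {η : PForm ι q} (h : Sm ω) (h' : Sm η) :
    Sm (ω ⋏ η) := by
  intro idx
  unfold EDS.wedge
  exact contDiff_const.mul (ContDiff.sum fun k _ => contDiff_const.mul ((h _).mul (h' _)))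

theorem Sm.add {p : ℕ} {ω η : PForm ι p} (h1 : Sm ω) (h2 : Sm η) : Sm (ω + η) :=
  fun idx => (h1 idx).add (h2 idx)
theorem Sm.neg {p : ℕ} {ω : PForm ι p} (h1 : Sm ω) : Sm (-ω) :=
  fun idx => (h1 idx).neg
theorem Sm.sub {p : ℕ} {ω η : PForm ι p} (h1 : Sm ω) (h2 : Sm η) : Sm (ω - η) :=
  fun idx => (h1 idx).sub (h2 idx)
theorem Sm.smul {p : ℕ} {ω : PForm ι p} (h1 : Sm ω) (c : ℝ) : Sm (c • ω) :=
  fun idx => (contDiff_const (c := c)).mul (h1 idx)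
theorem Sm.fsmul {p : ℕ} {ω : PForm ι p} (h1 : Sm ω) {f : Pt ι → ℝ}
    (hf : ContDiff ℝ (⊤ : ℕ∞) f) : Sm (fsmul f ω) :=
  fun idx => hf.mul (h1 idx)
theorem sm_zero {p : ℕ} : Sm (0 : PForm ι p) := fun _ => contDiff_const
theorem Sm.sum {p : ℕ} {κ : Type*} {s : Finset κ} {ω : κ → PForm ι p}
    (h : ∀ k, Sm (ω k)) : Sm (∑ k ∈ s, ω k) := by
  classical
  induction s using Finset.induction_on with
  | empty => simpa using sm_zero
  | insert a s ha ih => rw [Finset.sum_insert ha]; exact (h a).add ih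
theorem Sm.cast {p q : ℕ} (h : p = q) {ω : PForm ι p} (h1 : Sm ω) :
    Sm (PForm.cast h ω) := by
  subst h; exact h1

theorem pd_sum_mul {κ : Type*} (s : Finset κ) (c : κ → ℝ) (f : κ → Pt ι → ℝ) (u : ι) (x : Pt ι)
    (hf : ∀ k, DifferentiableAt ℝ (f k) x) :
    pd u (fun y => ∑ k ∈ s, c k * f k y) x = ∑ k ∈ s, c k * pd u (f k) x := by
  unfold pd
  rw [fderiv_fun_sum (fun k _ => (hf k).const_mul (c k))]
  simp only [_root_.sum_apply]
  refine Finset.sum_congr rfl fun k _ => ?_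
  rw [fderiv_const_mul (hf k)]
  simp

theorem pd_mul {f g : Pt ι → ℝ} (u : ι) (x : Pt ι)
    (hf : DifferentiableAt ℝ f x) (hg : DifferentiableAt ℝ g x) :
    pd u (fun y => f y * g y) x = pd u f x * g x + f x * pd u g x := by
  unfold pd
  rw [fderiv_fun_mul hf hg]
  simp; ring

theorem pd_add {f g : Pt ι → ℝ} (u : ι) (x : Pt ι)
    (hf : DifferentiableAt ℝ f x) (hg : DifferentiableAt ℝ g x) :
    pd u (f + g) x = pd u f x + pd u g x := by
  unfold pd
  rw [fderiv_add hf hg]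
  simp

theorem pd_const_mul {f : Pt ι → ℝ} (c : ℝ) (u : ι) (x : Pt ι)
    (hf : DifferentiableAt ℝ f x) :
    pd u (fun y => c * f y) x = c * pd u f x := by
  unfold pd
  rw [fderiv_const_mul hf]
  simp

theorem cf_bas_mul {p : ℕ} (u : ι) (J : Fin p → ι) (idx : Fin (p + 1) → ι) :
    cf idx (bas u * mon J) = ∑ k : Fin (p + 1), (-1 : ℝ) ^ (k : ℕ) *
      (Pi.single u (1:ℝ) : ι → ℝ) (idx k) * cf (idx ∘ k.succAbove) (mon J) := by
  rw [← mon_cons, cf_mon_det, Matrix.det_succ_row_zero]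
  simp_rw [cf_mon_det]
  rfl

theorem cf_bas_mul' {p : ℕ} (u : ι) {v : EA ι}
    (hv : v ∈ Submodule.span ℝ (Set.range (mon (ι := ι) (p := p)))) (idx : Fin (p + 1) → ι) :
    cf idx (bas u * v) = ∑ k : Fin (p + 1), (-1 : ℝ) ^ (k : ℕ) *
      (Pi.single u (1:ℝ) : ι → ℝ) (idx k) * cf (idx ∘ k.succAbove) v := by
  induction hv using Submodule.span_induction with
  | mem x h => obtain ⟨K, rfl⟩ := h; exact cf_bas_mul u K idx
  | zero => simp
  | add x y _ _ hx hy =>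
    simp only [mul_add, map_add, hx, hy, Finset.sum_add_distrib]
  | smul a x _ hx =>
    simp only [mul_smul_comm, map_smul, hx, smul_eq_mul, Finset.mul_sum]
    refine Finset.sum_congr rfl fun k _ => ?_
    ring

theorem mon_insertNth {p : ℕ} (k : Fin (p + 1)) (u : ι) (J : Fin p → ι) :
    mon (k.insertNth u J : Fin (p + 1) → ι) = (-1 : ℝ) ^ (k : ℕ) • (bas u * mon J) := by
  rw [← mon_cons]
  unfold mon
  have e : (fun t => (Pi.single ((k.insertNth u J : Fin (p + 1) → ι) t) (1:ℝ) : ι → ℝ)) =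
      k.insertNth (Pi.single u (1:ℝ) : ι → ℝ) (fun t => (Pi.single (J t) (1:ℝ) : ι → ℝ)) := by
    funext t
    refine Fin.succAboveCases k ?_ (fun i => ?_) t <;> simp
  have e0 : (fun t => (Pi.single ((Fin.cons u J : Fin (p + 1) → ι) t) (1:ℝ) : ι → ℝ)) =
      Matrix.vecCons (Pi.single u (1:ℝ) : ι → ℝ) (fun t => (Pi.single (J t) (1:ℝ) : ι → ℝ)) := by
    funext t
    refine Fin.cases ?_ (fun i => ?_) t <;> simp
  rw [e, e0, AlternatingMap.map_insertNth]
  rcases Nat.even_or_odd (k : ℕ) with h | h <;> simp [h.neg_one_pow]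

theorem Phi_extd {p : ℕ} (ω : PForm ι p) (x : Pt ι) :
    Phi (extd ω) x = ∑ u, bas u * Phi (pD u ω) x := by
  unfold Phi extd
  simp_rw [Finset.sum_smul]
  rw [Finset.sum_comm]
  have : ∀ k : Fin (p + 1), ∑ I : Fin (p + 1) → ι,
      ((-1 : ℝ) ^ (k : ℕ) * pd (I k) (ω (I ∘ k.succAbove)) x) • mon I =
      ∑ u, ∑ J : Fin p → ι, pd u (ω J) x • (bas u * mon J) := by
    intro k
    rw [← Finset.sum_product', Finset.univ_product_univ]
    symm
    refine Fintype.sum_equiv (Fin.insertNthEquiv (fun _ => ι) k) _ _ fun z => ?_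
    rw [show (Fin.insertNthEquiv (fun _ => ι) k) z = k.insertNth z.1 z.2 from rfl]
    rw [mon_insertNth, smul_smul]
    have e : (k.insertNth z.1 z.2 : Fin (p + 1) → ι) ∘ k.succAbove = z.2 := by
      ext t; simp
    rw [e, Fin.insertNth_apply_same, mul_right_comm, ← mul_pow]
    simp
  simp_rw [this]
  simp only [Finset.sum_const, Finset.card_univ, Fintype.card_fin]
  rw [← Nat.cast_smul_eq_nsmul ℝ, smul_smul, Nat.factorial_succ, Nat.cast_mul, mul_inv,
    mul_right_comm, inv_mul_cancel₀ (by positivity), one_mul, Finset.smul_sum]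
  refine Finset.sum_congr rfl fun u _ => ?_
  rw [mul_smul_comm, Finset.mul_sum]
  simp [pD]

theorem good_pD {p : ℕ} {ω : PForm ι p} (hg : Good ω) (hs : Sm ω) (u : ι) : Good (pD u ω) := by
  intro idx x
  have h : ω idx = fun y => ∑ I, ((p.factorial : ℝ)⁻¹ * cf idx (mon I)) * ω I y := by
    funext y
    rw [hg idx y]
    simp only [Phi, map_smul, map_sum, smul_eq_mul, Finset.mul_sum]
    refine Finset.sum_congr rfl fun k _ => ?_
    ring
  unfold pD
  rw [h, pd_sum_mul _ _ _ _ _ (fun k => hs.diff k x)]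
  simp only [Phi, map_smul, map_sum, smul_eq_mul, Finset.mul_sum]
  refine Finset.sum_congr rfl fun k _ => ?_
  ring

theorem Good.extd {p : ℕ} {ω : PForm ι p} (hg : Good ω) (hs : Sm ω) : Good (extd ω) := by
  intro idx x
  rw [Phi_extd, map_sum]
  simp_rw [cf_bas_mul' _ (Phi_mem _ _)]
  rw [Finset.sum_comm]
  unfold EDS.extd
  refine Finset.sum_congr rfl fun k _ => ?_
  rw [Finset.sum_eq_single (idx k)]
  · rw [← good_pD hg hs]
    simp [pD]
  · intro b _ hb
    simp [hb.symm]
  · simp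

theorem bas_Phi {p : ℕ} (u : ι) (ω : PForm ι p) (x : Pt ι) :
    bas u * Phi ω x = (-1 : ℝ) ^ p • (Phi ω x * bas u) := by
  unfold Phi
  simp_rw [mul_smul_comm, smul_mul_assoc, Finset.mul_sum, Finset.sum_mul, mul_smul_comm,
    smul_mul_assoc, bas_mon]
  rw [smul_comm]
  congr 1
  rw [Finset.smul_sum]
  refine Finset.sum_congr rfl fun k _ => ?_
  rw [smul_comm]

theorem pD_wedge {p q : ℕ} {ω : PForm ι p} {η : PForm ι q} (h : Sm ω) (h' : Sm η) (u : ι) :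
    pD u (ω ⋏ η) = pD u ω ⋏ η + ω ⋏ pD u η := by
  funext idx x
  unfold pD wedge
  rw [pd_const_mul]
  · rw [pd_sum_mul _ _ (fun (σ : Equiv.Perm (Fin (p + q))) y => ω (fun i => idx (σ (Fin.castAdd q i))) y *
      η (fun j => idx (σ (Fin.natAdd p j))) y) _ _ (fun k => (h.diff _ x).mul (h'.diff _ x))]
    simp only [Pi.add_apply]
    rw [← mul_add, ← Finset.sum_add_distrib]
    congr 1
    refine Finset.sum_congr rfl fun σ _ => ?_
    rw [pd_mul _ _ (h.diff _ x) (h'.diff _ x)]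
    ring
  · exact DifferentiableAt.fun_sum fun k _ => ((h.diff _ x).mul (h'.diff _ x)).const_mul _

theorem Phi_extd_wedge {p q : ℕ} {ω : PForm ι p} {η : PForm ι q} (h : Sm ω) (h' : Sm η)
    (x : Pt ι) : Phi (extd (ω ⋏ η)) x =
      Phi (extd ω) x * Phi η x + (-1 : ℝ) ^ p • (Phi ω x * Phi (extd η) x) := by
  simp_rw [Phi_extd, pD_wedge h h', Phi_add, Phi_wedge, mul_add, Finset.sum_add_distrib]
  congr 1
  · rw [Finset.sum_mul]; simp_rw [mul_assoc]
  · rw [Finset.mul_sum, Finset.smul_sum]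
    refine Finset.sum_congr rfl fun u _ => ?_
    rw [← mul_assoc, bas_Phi, smul_mul_assoc, mul_assoc]

theorem extd_add {p : ℕ} {ω η : PForm ι p} (h : Sm ω) (h' : Sm η) :
    extd (ω + η) = extd ω + extd η := by
  funext idx x
  unfold extd
  simp only [Pi.add_apply]
  rw [← Finset.sum_add_distrib]
  refine Finset.sum_congr rfl fun k _ => ?_
  rw [pd_add _ _ (h.diff _ x) (h'.diff _ x)]
  ring

theorem extd_smul {p : ℕ} {ω : PForm ι p} (h : Sm ω) (c : ℝ) :
    extd (c • ω) = c • extd ω := by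
  funext idx x
  unfold extd
  simp only [Pi.smul_apply, smul_eq_mul]
  rw [Finset.mul_sum]
  refine Finset.sum_congr rfl fun k _ => ?_
  have : pd (idx k) (c • ω (idx ∘ k.succAbove)) x = c * pd (idx k) (ω (idx ∘ k.succAbove)) x :=
    pd_const_mul c _ _ (h.diff _ x)
  rw [this]
  ring

theorem extd_neg {p : ℕ} {ω : PForm ι p} (h : Sm ω) : extd (-ω) = - extd ω := by
  have := extd_smul h (-1)
  simpa using this

theorem extd_sub {p : ℕ} {ω η : PForm ι p} (h : Sm ω) (h' : Sm η) :
    extd (ω - η) = extd ω - extd η := by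
  rw [sub_eq_add_neg, extd_add h h'.neg, extd_neg h', sub_eq_add_neg]

theorem extd_zero {p : ℕ} : extd (0 : PForm ι p) = 0 := by
  have := extd_smul (sm_zero (ι := ι) (p := p)) 0
  simpa using this

theorem extd_sum {p : ℕ} {κ : Type*} {s : Finset κ} {ω : κ → PForm ι p}
    (h : ∀ k, Sm (ω k)) : extd (∑ k ∈ s, ω k) = ∑ k ∈ s, extd (ω k) := by
  classical
  induction s using Finset.induction_on with
  | empty => simpa using extd_zero
  | insert a s ha ih =>
    rw [Finset.sum_insert ha, Finset.sum_insert ha, extd_add (h a) (Sm.sum h), ih]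

theorem Phi_extd_cast {p q : ℕ} (h : p = q) (ω : PForm ι p) (x : Pt ι) :
    Phi (extd (PForm.cast h ω)) x = Phi (extd ω) x := by
  subst h; rfl

theorem pd_comm {f : Pt ι → ℝ} (hf : ContDiff ℝ (⊤ : ℕ∞) f) (u v : ι) (x : Pt ι) :
    pd u (pd v f) x = pd v (pd u f) x := by
  have hd : DifferentiableAt ℝ (fderiv ℝ f) x :=
    (hf.fderiv_right (m := (⊤ : ℕ∞)) (by simp)).differentiable (by simp) x
  have key : ∀ a b : ι, pd a (pd b f) x =
      fderiv ℝ (fderiv ℝ f) x (Pi.single a 1) (Pi.single b 1) := by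
    intro a b
    unfold pd
    rw [fderiv_clm_apply hd (differentiableAt_const _)]
    simp
  rw [key, key]
  exact (hf.contDiffAt.isSymmSndFDerivAt (by rw [minSmoothness_of_isRCLikeNormedField]; exact WithTop.coe_le_coe.2 (le_top : (2 : ℕ∞) ≤ ⊤))) _ _

theorem Phi_extd_extd {p : ℕ} {ω : PForm ι p} (h : Sm ω) (x : Pt ι) :
    Phi (extd (extd ω)) x = 0 := by
  have hpD : ∀ u, pD u (extd ω) = extd (pD u ω) := by
    intro u
    funext idx y
    unfold pD extd
    rw [pd_sum_mul _ _ (fun k y => pd (idx k) (ω (idx ∘ k.succAbove)) y) _ _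
      (fun k => (sm_pd (h _) _).differentiable (by simp) y)]
    refine Finset.sum_congr rfl fun k _ => ?_
    congr 1
    exact pd_comm (h _) _ _ _
  have hc : ∀ u v, pD u (pD v ω) = pD v (pD u ω) := by
    intro u v
    funext idx y
    exact pd_comm (h _) _ _ _
  rw [Phi_extd]
  simp_rw [hpD, Phi_extd, Finset.mul_sum]
  set S := ∑ u, ∑ v, bas u * (bas v * Phi (pD v (pD u ω)) x) with hS
  have : S = -S := by
    conv_lhs => rw [hS, Finset.sum_comm]
    rw [hS, ← Finset.sum_neg_distrib]
    refine Finset.sum_congr rfl fun u _ => ?_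
    rw [← Finset.sum_neg_distrib]
    refine Finset.sum_congr rfl fun v _ => ?_
    rw [← mul_assoc, bas_swap, hc]
    rw [neg_mul, mul_assoc]
  have h2 : (2:ℝ) • S = 0 := by
    rw [two_smul]; nth_rewrite 1 [this]; simp
  exact (smul_eq_zero.mp h2).resolve_left (by norm_num)

end EDS

namespace EDS

def xx {n : ℕ} (i : Fin n) : YC n := Sum.inr (Sum.inr i)

theorem contDiff_coord {n : ℕ} (u : YC n) : ContDiff ℝ (⊤ : ℕ∞) (fun m : Pt (YC n) => m u) :=
  contDiff_apply ℝ ℝ u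

theorem pd_coord {n : ℕ} (u v : YC n) (x : Pt (YC n)) :
    pd u (fun m : Pt (YC n) => m v) x = (Pi.single v (1:ℝ) : YC n → ℝ) u := by
  unfold pd
  have : fderiv ℝ (fun m : Pt (YC n) => m v) x = ContinuousLinearMap.proj v :=
    (ContinuousLinearMap.proj (R := ℝ) (φ := fun _ : YC n => ℝ) v).fderiv
  rw [this]
  simp [Pi.single_apply, eq_comm]

theorem dx_apply {n : ℕ} (i : Fin n) (idx : Fin 1 → YC n) (x : Pt (YC n)) :
    dx n i idx x = (Pi.single (xx i) (1:ℝ) : YC n → ℝ) (idx 0) := by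
  unfold dx extd ofFun xc
  simp [pd_coord, xx]

theorem Phi_dx {n : ℕ} (i : Fin n) (x : Pt (YC n)) : Phi (dx n i) x = bas (xx i) := by
  unfold Phi
  rw [Finset.sum_eq_single (fun _ => xx i)]
  · rw [dx_apply]; simp [mon, bas]
  · intro I _ hI
    rw [dx_apply]
    have : I 0 ≠ xx i := fun h => hI (by funext t; rw [Subsingleton.elim t 0, h])
    simp [this]
  · simp

theorem wedgeFam_dx {n m : ℕ} (k : Fin m → Fin n) (idx : Fin m → YC n) (x : Pt (YC n)) :
    wedgeFam (fun t => dx n (k t)) idx x = cf idx (mon (xx ∘ k)) := by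
  unfold wedgeFam
  rw [cf_mon_det, ← Matrix.det_transpose, Matrix.det_apply']
  simp only [dx_apply]
  rfl

theorem Phi_wedgeFam {n m : ℕ} (k : Fin m → Fin n) (x : Pt (YC n)) :
    Phi (wedgeFam (fun t => dx n (k t))) x = mon (xx ∘ k) := by
  unfold Phi
  simp_rw [wedgeFam_dx]
  exact sum_cf_mon _

theorem sm_Ac {n : ℕ} (a : Fin 3) (i : Fin n) : ContDiff ℝ (⊤ : ℕ∞) (Ac n a i) :=
  contDiff_coord _

theorem sm_Fc {n : ℕ} (a : Fin 3) (i j : Fin n) : ContDiff ℝ (⊤ : ℕ∞) (Fc n a i j) := by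
  unfold Fc
  split_ifs
  · exact contDiff_coord _
  · exact (contDiff_coord _).neg
  · exact contDiff_const

theorem sm_dx {n : ℕ} (i : Fin n) : Sm (dx n i) :=
  Sm.extd (fun _ => contDiff_coord _)

theorem sm_wedgeFam {n m : ℕ} (k : Fin m → Fin n) : Sm (wedgeFam (fun t => dx n (k t))) := by
  intro idx
  have : wedgeFam (fun t => dx n (k t)) idx = fun _ => cf idx (mon (xx ∘ k)) := by
    funext x; exact wedgeFam_dx k idx x
  rw [this]
  exact contDiff_const

theorem sm_A {n : ℕ} (a : Fin 3) : Sm (Aform n a) :=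
  Sm.sum fun i => (sm_dx i).fsmul (sm_Ac a i)

theorem sm_F {n : ℕ} (a : Fin 3) : Sm (Fform n a) :=
  (Sm.sum fun i => Sm.sum fun j => ((sm_dx i).wedge (sm_dx j)).fsmul (sm_Fc a i j)).smul _

theorem sm_S {n : ℕ} (a : Fin 3) : Sm (starF n a) :=
  (Sm.sum fun i => Sm.sum fun j => Sm.sum fun k =>
    ((sm_wedgeFam k).fsmul (sm_Fc a i j)).smul _).smul _

section pDlin
theorem Phi_comm2 {ι : Type} [Fintype ι] [DecidableEq ι] {p : ℕ} (ω : PForm ι p)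
    (η : PForm ι 2) (x : Pt ι) : Phi ω x * Phi η x = Phi η x * Phi ω x := by
  have h : ∀ J : Fin 2 → ι, mon J * Phi ω x = Phi ω x * mon J := by
    intro J
    have e : mon J = bas (J 0) * bas (J 1) := by
      simp [mon, bas, Matrix.vecTail]
    rw [e, mul_assoc, bas_Phi, mul_smul_comm, ← mul_assoc, bas_Phi, smul_mul_assoc, smul_smul,
      ← mul_pow, mul_assoc]
    simp
  rw [Phi.eq_def η]
  simp only [mul_smul_comm, smul_mul_assoc, Finset.mul_sum, Finset.sum_mul, h]

variable {ι : Type} [Fintype ι] [DecidableEq ι]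

theorem pD_smul {p : ℕ} {ω : PForm ι p} (h : Sm ω) (c : ℝ) (u : ι) :
    pD u (c • ω) = c • pD u ω := by
  funext idx x
  exact pd_const_mul c _ _ (h.diff _ x)

theorem pD_add {p : ℕ} {ω η : PForm ι p} (h : Sm ω) (h' : Sm η) (u : ι) :
    pD u (ω + η) = pD u ω + pD u η := by
  funext idx x
  exact pd_add _ _ (h.diff _ x) (h'.diff _ x)

theorem pD_sum {p : ℕ} {κ : Type*} {s : Finset κ} {ω : κ → PForm ι p}
    (h : ∀ k, Sm (ω k)) (u : ι) : pD u (∑ k ∈ s, ω k) = ∑ k ∈ s, pD u (ω k) := by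
  classical
  induction s using Finset.induction_on with
  | empty =>
    have := pD_smul (sm_zero (ι := ι) (p := p)) 0 u
    simpa using this
  | insert a s ha ih =>
    rw [Finset.sum_insert ha, Finset.sum_insert ha, pD_add (h a) (Sm.sum h), ih]

theorem pD_fsmul {p : ℕ} {ω : PForm ι p} (h : ∀ idx x y, ω idx x = ω idx y) {f : Pt ι → ℝ}
    (hf : ContDiff ℝ (⊤ : ℕ∞) f) (u : ι) : pD u (fsmul f ω) = fsmul (pd u f) ω := by
  funext idx x
  have : fsmul f ω idx = fun y => ω idx x * f y := by
    funext y
    unfold fsmul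
    rw [h idx y x, mul_comm]
  unfold pD
  rw [this, pd_const_mul _ _ _ (hf.differentiable (by simp) x), mul_comm]
  rfl
end pDlin

def PP {n : ℕ} (f : Fin n → Fin n → ℝ) : EA (YC n) :=
  (1/2 : ℝ) • ∑ i, ∑ j, f i j • (bas (xx i) * bas (xx j))

def SS {n : ℕ} (f : Fin n → Fin n → ℝ) : EA (YC n) :=
  ((2 * (n - 2).factorial : ℕ) : ℝ)⁻¹ • ∑ i, ∑ j, ∑ k : Fin (n - 2) → Fin n,
    (etaD i * etaD j * (∏ t, etaD (k t)) * eps (raiseIdx i j k)) •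
      (f i j • mon (xx ∘ k))

theorem Phi_F {n : ℕ} (a : Fin 3) (x : Pt (YC n)) :
    Phi (Fform n a) x = PP (fun i j => Fc n a i j x) := by
  unfold Fform PP
  simp only [Phi_smul, Phi_sum, Phi_fsmul, Phi_wedge, Phi_dx]

theorem Phi_pD_F {n : ℕ} (a : Fin 3) (u : YC n) (x : Pt (YC n)) :
    Phi (pD u (Fform n a)) x = PP (fun i j => pd u (Fc n a i j) x) := by
  have h1 : ∀ i j, Sm (fsmul (Fc n a i j) (dx n i ⋏ dx n j)) :=
    fun i j => ((sm_dx i).wedge (sm_dx j)).fsmul (sm_Fc a i j)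
  have h2 : ∀ i j, pD u (fsmul (Fc n a i j) (dx n i ⋏ dx n j)) =
      fsmul (pd u (Fc n a i j)) (dx n i ⋏ dx n j) := by
    intro i j
    refine pD_fsmul (fun idx y z => ?_) (sm_Fc a i j) u
    simp only [wedge_eq, Phi_dx]
  unfold Fform PP
  rw [pD_smul (Sm.sum fun i => Sm.sum fun j => h1 i j), pD_sum (fun i => Sm.sum fun j => h1 i j)]
  simp_rw [fun i => pD_sum (s := Finset.univ) (h1 i) u, h2]
  simp only [Phi_smul, Phi_sum, Phi_fsmul, Phi_wedge, Phi_dx]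

theorem Phi_S {n : ℕ} (a : Fin 3) (x : Pt (YC n)) :
    Phi (starF n a) x = SS (fun i j => Fc n a i j x) := by
  unfold starF SS
  simp only [Phi_smul, Phi_sum, Phi_fsmul, Phi_wedgeFam]

theorem Phi_pD_S {n : ℕ} (a : Fin 3) (u : YC n) (x : Pt (YC n)) :
    Phi (pD u (starF n a)) x = SS (fun i j => pd u (Fc n a i j) x) := by
  have h0 : ∀ i j (k : Fin (n - 2) → Fin n),
      Sm (fsmul (Fc n a i j) (wedgeFam (fun t => dx n (k t)))) :=
    fun i j k => (sm_wedgeFam k).fsmul (sm_Fc a i j)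
  have h1 : ∀ i j (k : Fin (n - 2) → Fin n),
      Sm ((etaD i * etaD j * (∏ t, etaD (k t)) * eps (raiseIdx i j k)) •
        fsmul (Fc n a i j) (wedgeFam (fun t => dx n (k t)))) :=
    fun i j k => (h0 i j k).smul _
  have h2 : ∀ i j (k : Fin (n - 2) → Fin n),
      pD u (fsmul (Fc n a i j) (wedgeFam (fun t => dx n (k t)))) =
      fsmul (pd u (Fc n a i j)) (wedgeFam (fun t => dx n (k t))) := by
    intro i j k
    refine pD_fsmul (fun idx y z => ?_) (sm_Fc a i j) u
    simp only [wedgeFam_dx]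
  unfold starF SS
  rw [pD_smul (Sm.sum fun i => Sm.sum fun j => Sm.sum fun k => h1 i j k),
    pD_sum (fun i => Sm.sum fun j => Sm.sum fun k => h1 i j k)]
  rw [Phi_smul, Phi_sum]
  congr 1
  refine Finset.sum_congr rfl fun i _ => ?_
  rw [pD_sum (fun j => Sm.sum fun k => h1 i j k), Phi_sum]
  refine Finset.sum_congr rfl fun j _ => ?_
  rw [pD_sum (fun k => h1 i j k), Phi_sum]
  refine Finset.sum_congr rfl fun k _ => ?_
  rw [pD_smul (h0 i j k), h2, Phi_smul, Phi_fsmul, Phi_wedgeFam]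

theorem Phi_A {n : ℕ} (a : Fin 3) (x : Pt (YC n)) :
    Phi (Aform n a) x = ∑ i, Ac n a i x • bas (xx i) := by
  unfold Aform
  simp only [Phi_sum, Phi_fsmul, Phi_dx]

theorem mon_eps {n : ℕ} (L : Fin n → Fin n) : mon (xx ∘ L) = eps L • mon (xx (n := n)) := by
  unfold eps
  split_ifs with h
  · rw [← mon_perm]; rfl
  · rw [zero_smul]
    have hL : ¬ Function.Injective L := fun hi => h (Finite.injective_iff_bijective.1 hi)
    apply ExteriorAlgebra.ιMulti_eq_zero_of_not_inj
    intro hi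
    apply hL
    intro s t hst
    apply hi
    simp [hst]

theorem raise_cons {m : ℕ} (i j : Fin (m + 2)) (k : Fin m → Fin (m + 2)) :
    raiseIdx (n := m + 2) i j k = Fin.cons i (Fin.cons j k : Fin (m + 1) → Fin (m + 2)) := by
  funext t
  refine Fin.cases ?_ (fun t => ?_) t
  · simp [raiseIdx]
  · refine Fin.cases ?_ (fun t => ?_) t
    · simp [raiseIdx]
    · simp [raiseIdx]

theorem mon_raise' {m : ℕ} (i j : Fin (m + 2)) (k : Fin m → Fin (m + 2)) :
    bas (xx i) * bas (xx j) * mon (xx ∘ k) =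
      eps (raiseIdx (n := m + 2) i j k) • mon (xx (n := m + 2)) := by
  rw [← mon_eps, raise_cons, mul_assoc, ← mon_cons, ← mon_cons]
  congr 1
  funext t
  refine Fin.cases ?_ (fun t => ?_) t
  · simp
  · refine Fin.cases ?_ (fun t => ?_) t <;> simp

theorem mon_raise {n : ℕ} (hn : 2 ≤ n) (i j : Fin n) (k : Fin (n - 2) → Fin n) :
    bas (xx i) * bas (xx j) * mon (xx ∘ k) = eps (raiseIdx i j k) • mon (xx (n := n)) := by
  obtain ⟨m, rfl⟩ := Nat.exists_eq_add_of_le' hn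
  exact mon_raise' i j k

theorem eta_raise' {m : ℕ} (i j : Fin (m + 2)) (k : Fin m → Fin (m + 2)) :
    etaD i * etaD j * (∏ t, etaD (k t)) * eps (raiseIdx (n := m + 2) i j k) =
      (∏ t : Fin (m + 2), etaD t) * eps (raiseIdx (n := m + 2) i j k) := by
  by_cases h : Function.Bijective (raiseIdx (n := m + 2) i j k)
  · congr 1
    rw [← Equiv.prod_comp (Equiv.ofBijective _ h)]
    simp only [Equiv.ofBijective_apply]
    rw [raise_cons, Fin.prod_univ_succ, Fin.prod_univ_succ]
    simp [mul_assoc]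
  · rw [eps, dif_neg h, mul_zero, mul_zero]

theorem eta_raise {n : ℕ} (hn : 2 ≤ n) (i j : Fin n) (k : Fin (n - 2) → Fin n) :
    etaD i * etaD j * (∏ t, etaD (k t)) * eps (raiseIdx i j k) =
      (∏ t : Fin n, etaD t) * eps (raiseIdx i j k) := by
  obtain ⟨m, rfl⟩ := Nat.exists_eq_add_of_le' hn
  exact eta_raise' i j k

theorem sum4_swap {n : ℕ} {M : Type*} [AddCommMonoid M] (X : Fin n → Fin n → Fin n → Fin n → M) :
    ∑ i, ∑ j, ∑ k, ∑ l, X i j k l = ∑ i, ∑ j, ∑ k, ∑ l, X k l i j := by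
  have := Finset.sum_comm (s := Finset.univ) (t := Finset.univ)
    (f := fun z w : Fin n × Fin n => X z.1 z.2 w.1 w.2)
  simpa only [Fintype.sum_prod_type] using this

theorem PP_SS_formula {n : ℕ} (hn : 2 ≤ n) (f g : Fin n → Fin n → ℝ) :
    PP f * SS g = ((1/2 : ℝ) * ((2 * (n - 2).factorial : ℕ) : ℝ)⁻¹) •
      ∑ i, ∑ j, ∑ k, ∑ l, ∑ K : Fin (n - 2) → Fin n,
        ((∏ t : Fin n, etaD t) * f i j * g k l * eps (raiseIdx i j K) * eps (raiseIdx k l K)) •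
          mon (xx (n := n)) := by
  unfold PP SS
  rw [smul_mul_smul_comm]
  congr 1
  simp_rw [Finset.sum_mul]
  refine Finset.sum_congr rfl fun i _ => Finset.sum_congr rfl fun j _ => ?_
  simp_rw [Finset.mul_sum]
  refine Finset.sum_congr rfl fun k _ => Finset.sum_congr rfl fun l _ =>
    Finset.sum_congr rfl fun K _ => ?_
  rw [eta_raise hn, smul_mul_assoc, mul_smul_comm, mul_smul_comm, mon_raise hn]
  simp only [smul_smul]
  congr 1
  ring

theorem PP_SS {n : ℕ} (hn : 2 ≤ n) (f g : Fin n → Fin n → ℝ) : PP f * SS g = PP g * SS f := by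
  rw [PP_SS_formula hn, PP_SS_formula hn, sum4_swap]
  congr 1
  refine Finset.sum_congr rfl fun i _ => Finset.sum_congr rfl fun j _ =>
    Finset.sum_congr rfl fun k _ => Finset.sum_congr rfl fun l _ =>
    Finset.sum_congr rfl fun K _ => ?_
  congr 1
  ring

theorem dF_S {n : ℕ} (hn : 2 ≤ n) (a : Fin 3) (x : Pt (YC n)) :
    Phi (extd (Fform n a)) x * Phi (starF n a) x = Phi (Fform n a) x * Phi (extd (starF n a)) x := by
  rw [Phi_extd, Phi_extd, Finset.sum_mul, Finset.mul_sum]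
  refine Finset.sum_congr rfl fun u _ => ?_
  have h := bas_Phi u (Fform n a) x
  rw [← mul_assoc (Phi (Fform n a) x)]
  have h' : Phi (Fform n a) x * bas u = bas u * Phi (Fform n a) x := by rw [h]; simp
  rw [h', mul_assoc, mul_assoc, Phi_pD_F, Phi_pD_S, Phi_S, Phi_F, PP_SS hn]

/-! horizontality -/

def Hs (n : ℕ) : Submodule ℝ (EA (YC n)) :=
  Submodule.span ℝ (Set.range (fun i : Fin n => bas (xx i)))

theorem bas_mem {n : ℕ} (i : Fin n) : bas (xx i) ∈ Hs n := Submodule.subset_span ⟨i, rfl⟩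

theorem mon_mem {n p : ℕ} (k : Fin p → Fin n) : mon (xx ∘ k) ∈ Hs n ^ p := by
  induction p with
  | zero => simp [mon]
  | succ p ih =>
    have : (xx ∘ k : Fin (p + 1) → YC n) = Fin.cons (xx (k 0)) (xx ∘ (Fin.tail k)) := by
      funext t
      refine Fin.cases ?_ (fun t => ?_) t <;> simp [Fin.tail]
    rw [this, mon_cons, pow_succ']
    exact Submodule.mul_mem_mul (bas_mem _) (ih _)

theorem Hs_bot (n : ℕ) : Hs n ^ (n + 1) = ⊥ := by
  unfold Hs
  rw [Submodule.span_pow, Submodule.span_eq_bot]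
  intro v hv
  obtain ⟨f, rfl⟩ := Set.mem_pow.mp hv
  choose L hL using fun i => (f i).2
  have : (List.ofFn fun i => ((f i : EA (YC n)))).prod = mon (xx ∘ L) := by
    unfold mon
    rw [ExteriorAlgebra.ιMulti_apply]
    congr 2
    funext i
    rw [← hL i]
    rfl
  rw [this]
  apply ExteriorAlgebra.ιMulti_eq_zero_of_not_inj
  intro hi
  have hLi : Function.Injective L := by
    intro s t hst
    apply hi
    simp [hst]
  have := Fintype.card_le_of_injective L hLi
  simp at this

theorem A_mem {n : ℕ} (a : Fin 3) (x : Pt (YC n)) : Phi (Aform n a) x ∈ Hs n := by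
  rw [Phi_A]
  exact Submodule.sum_mem _ fun i _ => Submodule.smul_mem _ _ (bas_mem i)

theorem F_mem {n : ℕ} (a : Fin 3) (x : Pt (YC n)) : Phi (Fform n a) x ∈ Hs n * Hs n := by
  rw [Phi_F]
  exact Submodule.smul_mem _ _ (Submodule.sum_mem _ fun i _ => Submodule.sum_mem _ fun j _ =>
    Submodule.smul_mem _ _ (Submodule.mul_mem_mul (bas_mem i) (bas_mem j)))

theorem S_mem {n : ℕ} (a : Fin 3) (x : Pt (YC n)) : Phi (starF n a) x ∈ Hs n ^ (n - 2) := by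
  rw [Phi_S]
  exact Submodule.smul_mem _ _ (Submodule.sum_mem _ fun i _ => Submodule.sum_mem _ fun j _ =>
    Submodule.sum_mem _ fun k _ => Submodule.smul_mem _ _ (Submodule.smul_mem _ _ (mon_mem k)))

theorem HHHS {n : ℕ} (hn : 2 ≤ n) {v w z : EA (YC n)} (hv : v ∈ Hs n * Hs n) (hw : w ∈ Hs n)
    (hz : z ∈ Hs n ^ (n - 2)) : v * (w * z) = 0 := by
  have h := Submodule.mul_mem_mul hv (Submodule.mul_mem_mul hw hz)
  rw [← pow_two, ← pow_succ', ← pow_add, show 2 + (n - 2 + 1) = n + 1 by omega, Hs_bot] at h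
  simpa using h

/-! structure constants -/

theorem eps_perm {m : ℕ} (f : Fin m → Fin m) (σ : Equiv.Perm (Fin m)) :
    eps (f ∘ σ) = ((Equiv.Perm.sign σ : ℤ) : ℝ) * eps f := by
  unfold eps
  by_cases h : Function.Bijective f
  · have h' : Function.Bijective (f ∘ σ) := h.comp σ.bijective
    rw [dif_pos h, dif_pos h']
    have : Equiv.ofBijective (f ∘ σ) h' = Equiv.ofBijective f h * σ := by ext; rfl
    rw [this, Equiv.Perm.sign_mul]
    push_cast; ring
  · have h' : ¬ Function.Bijective (f ∘ σ) := by
      intro hc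
      apply h
      exact (Function.Bijective.of_comp_iff f σ.bijective).1 hc
    rw [dif_neg h, dif_neg h', mul_zero]

theorem gam_swap12 (a b c : Fin 3) : gam b a c = - gam a b c := by
  unfold gam
  have := eps_perm ![a, b, c] (Equiv.swap 0 1)
  rw [Equiv.Perm.sign_swap (by decide)] at this
  have e : (![a, b, c] ∘ (Equiv.swap 0 1 : Equiv.Perm (Fin 3))) = ![b, a, c] := by
    funext t; fin_cases t <;> rfl
  rw [e] at this
  simpa using this

theorem gam_swap23 (a b c : Fin 3) : gam a c b = - gam a b c := by
  unfold gam
  have := eps_perm ![a, b, c] (Equiv.swap 1 2)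
  rw [Equiv.Perm.sign_swap (by decide)] at this
  have e : (![a, b, c] ∘ (Equiv.swap 1 2 : Equiv.Perm (Fin 3))) = ![a, c, b] := by
    funext t; fin_cases t <;> rfl
  rw [e] at this
  simpa using this

theorem alg_main {E : Type*} [Ring E] [Algebra ℝ E] (g : Fin 3 → Fin 3 → Fin 3 → ℝ)
    (g1 : ∀ a b c, g b a c = - g a b c) (g2 : ∀ a b c, g a c b = - g a b c)
    (a da f s ds : Fin 3 → E)
    (h1 : ∀ i j, a i * da j = da j * a i) (h2 : ∀ i j, ds i * da j = da j * ds i)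
    (h3 : ∀ i j k, f i * (a j * s k) = 0) (h4 : ∀ i j k l, a i * (a j * (a k * s l)) = 0) :
    -(∑ i, ds i * da i) + ∑ i, f i * ds i -
      (1/8 : ℝ) • ∑ i, ∑ j, ∑ k, g k i j •
        ((da i * a j - a i * da j) * s k + a i * a j * ds k) =
    ∑ i, (da i - f i + (1/8 : ℝ) • ∑ b, ∑ c, g i b c • (a b * a c)) *
      (-(ds i) - (1/4 : ℝ) • ∑ b, ∑ c, g c i b • (a b * s c)) := by
  have z1 : ∀ b c, g b b c = 0 := fun b c => by have := g1 b b c; linarith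
  have z2 : ∀ b c, g b c c = 0 := fun b c => by have := g2 b c c; linarith
  have z3 : ∀ b c, g b c b = 0 := fun b c => by rw [g1, z2]; simp
  have e1 : g 0 2 1 = - g 0 1 2 := g2 0 1 2
  have e2 : g 1 0 2 = - g 0 1 2 := g1 0 1 2
  have e3 : g 1 2 0 = g 0 1 2 := by rw [g2 1 0 2, e2]; simp
  have e4 : g 2 0 1 = g 0 1 2 := by rw [g1 0 2 1, e1]; simp
  have e5 : g 2 1 0 = - g 0 1 2 := by rw [g2 2 0 1, e4]
  obtain ⟨q, e0⟩ : ∃ q, g 0 1 2 = q := ⟨_, rfl⟩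
  rw [e0] at e1 e2 e3 e4 e5
  simp only [Fin.sum_univ_three, z1, z2, z3, e0, e1, e2, e3, e4, e5, h1, h2]
  simp only [zero_smul, add_zero, zero_add, mul_add, add_mul, mul_sub, sub_mul, smul_add,
    smul_mul_assoc, mul_smul_comm, mul_assoc, h3, h4, mul_neg, neg_mul, smul_zero, neg_smul,
    smul_neg, neg_zero]
  module

end EDS


theorem stmt12 (n : ℕ) (hn : 3 ≤ n) :
    extd (PForm.cast (show n - 2 + (1 + 1) = n by omega) (-(∑ a, starF n a ⋏ extd (Aform n a))) +
        PForm.cast (show 2 + (n - 2) = n by omega) ((1/2 : ℝ) • ∑ a, Fform n a ⋏ starF n a) -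
        PForm.cast (show 1 + 1 + (n - 2) = n by omega)
          ((1/8 : ℝ) • ∑ a, ∑ b, ∑ c, gam c a b • (Aform n a ⋏ Aform n b ⋏ starF n c))) =
      PForm.cast (show 2 + (n - 2 + 1) = n + 1 by omega) (∑ a, theta n a ⋏ psi n a) ∧
    extd (∑ a, theta n a ⋏ psi n a) = 0 := by 
  have hn2 : 2 ≤ n := by omega
  have sL1 : Sm (-(∑ a, starF n a ⋏ extd (Aform n a))) :=
    (Sm.sum fun a => (sm_S a).wedge (sm_A a).extd).neg
  have sL2 : Sm ((1/2 : ℝ) • ∑ a, Fform n a ⋏ starF n a) :=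
    (Sm.sum fun a => (sm_F a).wedge (sm_S a)).smul _
  have sL3 : Sm ((1/8 : ℝ) • ∑ a, ∑ b, ∑ c, gam c a b • (Aform n a ⋏ Aform n b ⋏ starF n c)) :=
    (Sm.sum fun a => Sm.sum fun b => Sm.sum fun c =>
      (((sm_A a).wedge (sm_A b)).wedge (sm_S c)).smul _).smul _
  have gL1 : Good (-(∑ a, starF n a ⋏ extd (Aform n a))) :=
    (Good.sum fun a => good_wedge _ _).neg
  have gL2 : Good ((1/2 : ℝ) • ∑ a, Fform n a ⋏ starF n a) :=
    (Good.sum fun a => good_wedge _ _).smul _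
  have gL3 : Good ((1/8 : ℝ) • ∑ a, ∑ b, ∑ c, gam c a b • (Aform n a ⋏ Aform n b ⋏ starF n c)) :=
    (Good.sum fun a => Good.sum fun b => Good.sum fun c => (good_wedge _ _).smul _).smul _
  have sth : ∀ a, Sm (theta n a) := fun a =>
    ((sm_A a).extd.sub (sm_F a)).add
      ((Sm.sum fun b => Sm.sum fun c => ((sm_A b).wedge (sm_A c)).smul _).smul _)
  have sps : ∀ a, Sm (psi n a) := fun a =>
    (sm_S a).extd.neg.sub (Sm.cast _
      ((Sm.sum fun b => Sm.sum fun c => ((sm_A b).wedge (sm_S c)).smul _).smul _))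
  have sR : Sm (∑ a, theta n a ⋏ psi n a) := Sm.sum fun a => (sth a).wedge (sps a)
  have gR : Good (∑ a, theta n a ⋏ psi n a) := Good.sum fun a => good_wedge _ _
  have main :
    extd (PForm.cast (show n - 2 + (1 + 1) = n by omega) (-(∑ a, starF n a ⋏ extd (Aform n a))) +
        PForm.cast (show 2 + (n - 2) = n by omega) ((1/2 : ℝ) • ∑ a, Fform n a ⋏ starF n a) -
        PForm.cast (show 1 + 1 + (n - 2) = n by omega)
          ((1/8 : ℝ) • ∑ a, ∑ b, ∑ c, gam c a b • (Aform n a ⋏ Aform n b ⋏ starF n c))) =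
      PForm.cast (show 2 + (n - 2 + 1) = n + 1 by omega) (∑ a, theta n a ⋏ psi n a) := by
    refine Good.ext ?_ (gR.cast _) fun x => ?_
    · exact Good.extd (((gL1.cast _).add (gL2.cast _)).sub (gL3.cast _))
        (((sL1.cast _).add (sL2.cast _)).sub (sL3.cast _))
    · rw [extd_sub ((sL1.cast _).add (sL2.cast _)) (sL3.cast _),
        extd_add (sL1.cast _) (sL2.cast _), Phi_sub, Phi_add, Phi_extd_cast, Phi_extd_cast,
        Phi_extd_cast, Phi_cast]
      have t1 : Phi (extd (-(∑ a, starF n a ⋏ extd (Aform n a)))) x =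
          -(∑ a, Phi (extd (starF n a)) x * Phi (extd (Aform n a)) x) := by
        rw [extd_neg (Sm.sum fun a => (sm_S a).wedge (sm_A a).extd),
          extd_sum (fun a => (sm_S a).wedge (sm_A a).extd), Phi_neg, Phi_sum]
        congr 1
        refine Finset.sum_congr rfl fun a _ => ?_
        rw [Phi_extd_wedge (sm_S a) (sm_A a).extd, Phi_extd_extd (sm_A a), mul_zero, smul_zero,
          add_zero]
      have t2 : Phi (extd ((1/2 : ℝ) • ∑ a, Fform n a ⋏ starF n a)) x =
          ∑ a, Phi (Fform n a) x * Phi (extd (starF n a)) x := by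
        rw [extd_smul (Sm.sum fun a => (sm_F a).wedge (sm_S a)),
          extd_sum (fun a => (sm_F a).wedge (sm_S a)), Phi_smul, Phi_sum, Finset.smul_sum]
        refine Finset.sum_congr rfl fun a _ => ?_
        rw [Phi_extd_wedge (sm_F a) (sm_S a), dF_S hn2]
        module
      have t3 : Phi (extd ((1/8 : ℝ) • ∑ a, ∑ b, ∑ c,
            gam c a b • (Aform n a ⋏ Aform n b ⋏ starF n c))) x =
          (1/8 : ℝ) • ∑ a, ∑ b, ∑ c, gam c a b •
            ((Phi (extd (Aform n a)) x * Phi (Aform n b) x -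
                Phi (Aform n a) x * Phi (extd (Aform n b)) x) * Phi (starF n c) x +
              Phi (Aform n a) x * Phi (Aform n b) x * Phi (extd (starF n c)) x) := by
        have w : ∀ a b c, Sm (Aform n a ⋏ Aform n b ⋏ starF n c) :=
          fun a b c => ((sm_A a).wedge (sm_A b)).wedge (sm_S c)
        rw [extd_smul (Sm.sum fun a => Sm.sum fun b => Sm.sum fun c => (w a b c).smul _),
          extd_sum (fun a => Sm.sum fun b => Sm.sum fun c => (w a b c).smul _), Phi_smul, Phi_sum]
        congr 1
        refine Finset.sum_congr rfl fun a _ => ?_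
        rw [extd_sum (fun b => Sm.sum fun c => (w a b c).smul _), Phi_sum]
        refine Finset.sum_congr rfl fun b _ => ?_
        rw [extd_sum (fun c => (w a b c).smul _), Phi_sum]
        refine Finset.sum_congr rfl fun c _ => ?_
        rw [extd_smul (w a b c), Phi_smul, Phi_extd_wedge ((sm_A a).wedge (sm_A b)) (sm_S c),
          Phi_extd_wedge (sm_A a) (sm_A b), Phi_wedge]
        congr 1
        simp [sub_eq_add_neg]
      rw [t1, t2, t3, Phi_sum]
      have comm2 : ∀ {p : ℕ} (ω : PForm (YC n) p) (b : Fin 3),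
          Phi ω x * Phi (extd (Aform n b)) x = Phi (extd (Aform n b)) x * Phi ω x := by
        intro p ω b
        exact Phi_comm2 ω _ x
      rw [alg_main gam (fun a b c => gam_swap12 a b c) (fun a b c => gam_swap23 a b c)
        (fun a => Phi (Aform n a) x) (fun a => Phi (extd (Aform n a)) x)
        (fun a => Phi (Fform n a) x) (fun a => Phi (starF n a) x)
        (fun a => Phi (extd (starF n a)) x) (fun i j => comm2 _ j) (fun i j => comm2 _ j)
        (fun i j k => HHHS hn2 (F_mem i x) (A_mem j x) (S_mem k x))
        (fun i j k l => by
          rw [← mul_assoc]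
          exact HHHS hn2 (Submodule.mul_mem_mul (A_mem i x) (A_mem j x)) (A_mem k x) (S_mem l x))]
      refine Finset.sum_congr rfl fun a _ => ?_
      rw [Phi_wedge]
      unfold theta psi
      simp only [Phi_add, Phi_sub, Phi_neg, Phi_cast, Phi_smul, Phi_sum, Phi_wedge]
  refine ⟨main, ?_⟩
  refine Good.ext (gR.extd sR) good_zero fun x => ?_
  rw [← Phi_extd_cast (show 2 + (n - 2 + 1) = n + 1 by omega), ← main, Phi_zero]
  exact Phi_extd_extd (((sL1.cast _).add (sL2.cast _)).sub (sL3.cast _)) x
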